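/- arXiv:1603.08414 — 8 statements merged into one kernel-verified Lean document; each statement's English description precedes it below -/
import Mathlib

section
/- Let k ≥ 1 be an integer and let Φ : M₂(ℂ) → M₂(ℂ) be a map whose range contains every rank-one matrix. Then Φ satisfies [Φ(A), Φ(B)]_k = [A, B]_k for all A, B ∈ M₂(ℂ) if and only if there exist a function h : M₂(ℂ) → ℂ and a scalar λ ∈ ℂ with λ^{k+1} = 1 such that Φ(A) = λ·A + h(A)·I for all A ∈ M₂(ℂ). -/
/-- The k-commutator: `kComm 0 A B = A`, `kComm (k+1) A B = [kComm k A B, B]`. -/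
def kComm {𝔽 : Type*} [Field 𝔽] : ℕ → Matrix (Fin 2) (Fin 2) 𝔽 → Matrix (Fin 2) (Fin 2) 𝔽 → Matrix (Fin 2) (Fin 2) 𝔽
  | 0, A, _ => A
  | n + 1, A, B => kComm n A B * B - B * kComm n A B

open Matrix

section kComm

variable {𝔽 : Type*} [Field 𝔽]

theorem kComm_sub (k : ℕ) (X Y B : Matrix (Fin 2) (Fin 2) 𝔽) :
    kComm k (X - Y) B = kComm k X B - kComm k Y B := by
  induction k with
  | zero => rfl
  | succ n ih => simp only [kComm, ih]; noncomm_ring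

theorem kComm_smul (k : ℕ) (c : 𝔽) (X B : Matrix (Fin 2) (Fin 2) 𝔽) :
    kComm k (c • X) B = c • kComm k X B := by
  induction k with
  | zero => rfl
  | succ n ih => simp only [kComm, ih, smul_mul_assoc, mul_smul_comm, smul_sub]

theorem kComm_succ' (k : ℕ) (X B : Matrix (Fin 2) (Fin 2) 𝔽) :
    kComm (k + 1) X B = kComm k (X * B - B * X) B := by
  induction k with
  | zero => rfl
  | succ n ih => rw [kComm, ih, kComm]

theorem kComm_add_smul_one_left {k : ℕ} (hk : 1 ≤ k) (c : 𝔽)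
    (X B : Matrix (Fin 2) (Fin 2) 𝔽) : kComm k (X + c • 1) B = kComm k X B := by
  obtain ⟨n, rfl⟩ := Nat.exists_eq_add_of_le' hk
  simp [kComm_succ', add_mul, mul_add]

theorem kComm_smul_add_smul_one_right (k : ℕ) (c d : 𝔽)
    (X B : Matrix (Fin 2) (Fin 2) 𝔽) : kComm k X (c • B + d • 1) = c ^ k • kComm k X B := by
  induction k with
  | zero => simp [kComm]
  | succ n ih =>
    simp only [kComm, ih, pow_succ, mul_add, add_mul, smul_mul_assoc, mul_smul_comm, mul_one,
      one_mul, smul_sub, smul_add, smul_smul]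
    rw [mul_comm c (c ^ n), mul_comm d (c ^ n)]
    abel

/-- Iterating the commutator with a `2 × 2` matrix three times is the same as taking it once and
multiplying by the discriminant of the characteristic polynomial. -/
theorem kComm_three (X B : Matrix (Fin 2) (Fin 2) 𝔽) :
    kComm 3 X B = (B.trace ^ 2 - 4 * B.det) • kComm 1 X B := by
  ext i j
  fin_cases i <;> fin_cases j <;>
    simp [kComm, Matrix.mul_apply, Fin.sum_univ_two, Matrix.trace, Matrix.det_fin_two] <;> ring

theorem commute_of_kComm_eq_zero {B : Matrix (Fin 2) (Fin 2) 𝔽}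
    (hB : B.trace ^ 2 - 4 * B.det ≠ 0) {k : ℕ} {X : Matrix (Fin 2) (Fin 2) 𝔽}
    (h : kComm k X B = 0) : Commute X B := by
  have step : ∀ n, kComm (n + 1) X B = 0 → kComm 1 X B = 0 := by
    intro n
    induction n with
    | zero => exact id
    | succ n ih =>
      intro h
      have h₃ : kComm 3 (kComm n X B) B = 0 := by simp only [kComm] at h ⊢; simp [h]
      rw [kComm_three] at h₃
      exact ih ((smul_eq_zero.1 h₃).resolve_left hB)
  refine sub_eq_zero.1 (step k ?_)
  simp [kComm, h]

theorem trace_kComm_mul_self {k : ℕ} (hk : 1 ≤ k) (X B : Matrix (Fin 2) (Fin 2) 𝔽) :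
    (kComm k X B * B).trace = 0 := by
  obtain ⟨n, rfl⟩ := Nat.exists_eq_add_of_le' hk
  rw [kComm, sub_mul, trace_sub, mul_assoc B, trace_mul_comm B, sub_self]

theorem trace_kComm_mul (k : ℕ) (A X B : Matrix (Fin 2) (Fin 2) 𝔽) :
    (kComm k A B * X).trace = (-1) ^ k * (A * kComm k X B).trace := by
  induction k generalizing X with
  | zero => simp [kComm]
  | succ n ih =>
    have h : (kComm (n + 1) A B * X).trace = -(kComm n A B * (X * B - B * X)).trace := by
      rw [kComm, sub_mul, mul_sub, trace_sub, trace_sub, mul_assoc B, trace_mul_comm B]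
      simp only [mul_assoc]
      ring
    rw [h, ih, kComm_succ']
    ring

/-- A map preserving `k`-commutators sends every matrix with distinct eigenvalues into its
commutant. -/
theorem commute_map_self_of_kComm_preserving {k : ℕ} (hk : 1 ≤ k)
    {Φ : Matrix (Fin 2) (Fin 2) 𝔽 → Matrix (Fin 2) (Fin 2) 𝔽}
    (hΦ : ∀ A B, kComm k (Φ A) (Φ B) = kComm k A B) {B : Matrix (Fin 2) (Fin 2) 𝔽}
    (hB : B.trace ^ 2 - 4 * B.det ≠ 0) : Commute (Φ B) B := by
  refine commute_of_kComm_eq_zero hB (k := k) (Matrix.ext_iff_trace_mul_left.2 fun A => ?_)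
  have h := trace_kComm_mul k A (Φ B) B
  rw [← hΦ, trace_kComm_mul_self hk] at h
  simpa using h.symm

theorem eq_smul_add_smul_one_of_commute {t : 𝔽} {X : Matrix (Fin 2) (Fin 2) 𝔽}
    (h : Commute X !![t, 1; 1, 0]) : X = X 0 1 • !![t, 1; 1, 0] + X 1 1 • 1 := by
  have h₀₀ := congrFun (congrFun h.eq 0) 0
  have h₀₁ := congrFun (congrFun h.eq 0) 1
  simp [Matrix.mul_apply, Fin.sum_univ_two] at h₀₀ h₀₁
  ext i j
  fin_cases i <;> fin_cases j <;> simp <;> grind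

theorem eq_smul_one_of_commute_of_commute {t s : 𝔽} (hts : t ≠ s)
    {X : Matrix (Fin 2) (Fin 2) 𝔽} (ht : Commute X !![t, 1; 1, 0])
    (hs : Commute X !![s, 1; 1, 0]) : X = X 1 1 • 1 := by
  have h₁ := congrFun (congrFun ht.eq 0) 1
  have h₂ := congrFun (congrFun hs.eq 0) 1
  simp [Matrix.mul_apply, Fin.sum_univ_two] at h₁ h₂
  have h₀ : X 0 1 = 0 := by
    have : (t - s) * X 0 1 = 0 := by linear_combination h₂ - h₁
    exact (mul_eq_zero.1 this).resolve_left (sub_ne_zero.2 hts)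
  have h := eq_smul_add_smul_one_of_commute ht
  rwa [h₀, zero_smul, zero_add] at h

theorem commute_smul_sub_of_kComm_preserving {k : ℕ}
    {Φ : Matrix (Fin 2) (Fin 2) 𝔽 → Matrix (Fin 2) (Fin 2) 𝔽}
    (hΦ : ∀ A B, kComm k (Φ A) (Φ B) = kComm k A B) {B : Matrix (Fin 2) (Fin 2) 𝔽}
    (hB : B.trace ^ 2 - 4 * B.det ≠ 0) {c d : 𝔽} (h : Φ B = c • B + d • 1)
    (A : Matrix (Fin 2) (Fin 2) 𝔽) : Commute (c ^ k • Φ A - A) B := by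
  refine commute_of_kComm_eq_zero hB (k := k) ?_
  rw [kComm_sub, kComm_smul, ← kComm_smul_add_smul_one_right k c d, ← h, hΦ, sub_self]

theorem pow_mul_eq_one_of_kComm_preserving {k : ℕ}
    {Φ : Matrix (Fin 2) (Fin 2) 𝔽 → Matrix (Fin 2) (Fin 2) 𝔽}
    (hΦ : ∀ A B, kComm k (Φ A) (Φ B) = kComm k A B) {t s : 𝔽} (hts : t ≠ s)
    (ht : t ^ 2 + 4 ≠ 0) {c d c' d' : 𝔽}
    (h : Φ !![t, 1; 1, 0] = c • !![t, 1; 1, 0] + d • 1)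
    (h' : Φ !![s, 1; 1, 0] = c' • !![s, 1; 1, 0] + d' • 1) : c ^ k * c' = 1 := by
  have hc := commute_smul_sub_of_kComm_preserving hΦ
    (by simpa [Matrix.trace, Matrix.det_fin_two] using ht) h !![s, 1; 1, 0]
  rw [h'] at hc
  have h₁ := congrFun (congrFun hc.eq 0) 1
  simp [Matrix.mul_apply, Fin.sum_univ_two] at h₁
  have : (t - s) * (c ^ k * c' - 1) = 0 := by linear_combination -h₁
  exact sub_eq_zero.1 ((mul_eq_zero.1 this).resolve_left (sub_ne_zero.2 hts))

end kComm

theorem strong_k_commutativity_preserving_complex (k : ℕ) (hk : 1 ≤ k)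
    (Φ : Matrix (Fin 2) (Fin 2) ℂ → Matrix (Fin 2) (Fin 2) ℂ)
    (hrange : ∀ T : Matrix (Fin 2) (Fin 2) ℂ, T.rank = 1 → ∃ A, Φ A = T) :
    (∀ A B : Matrix (Fin 2) (Fin 2) ℂ, kComm k (Φ A) (Φ B) = kComm k A B) ↔
      ∃ (h : Matrix (Fin 2) (Fin 2) ℂ → ℂ) (lam : ℂ), lam ^ (k + 1) = 1 ∧
        ∀ A : Matrix (Fin 2) (Fin 2) ℂ, Φ A = lam • A + h A • 1 := by
  constructor
  · intro hΦ
    have disc : ∀ t : ℂ, t ^ 2 + 4 ≠ 0 →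
        (!![t, 1; 1, 0]).trace ^ 2 - 4 * (!![t, 1; 1, 0]).det ≠ 0 := fun t ht => by
      simpa [Matrix.trace, Matrix.det_fin_two] using ht
    have form : ∀ t : ℂ, t ^ 2 + 4 ≠ 0 →
        ∃ c d : ℂ, Φ !![t, 1; 1, 0] = c • !![t, 1; 1, 0] + d • 1 := fun t ht =>
      ⟨_, _, eq_smul_add_smul_one_of_commute
        (commute_map_self_of_kComm_preserving hk hΦ (disc t ht))⟩
    have h0 : (0 : ℂ) ^ 2 + 4 ≠ 0 := by norm_num
    have h1 : (1 : ℂ) ^ 2 + 4 ≠ 0 := by norm_num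
    have h2 : (2 : ℂ) ^ 2 + 4 ≠ 0 := by norm_num
    obtain ⟨a, a', ha⟩ := form 0 h0
    obtain ⟨b, b', hb⟩ := form 1 h1
    obtain ⟨c, c', hc⟩ := form 2 h2
    have hab := pow_mul_eq_one_of_kComm_preserving hΦ (by norm_num) h0 ha hb
    have hac := pow_mul_eq_one_of_kComm_preserving hΦ (by norm_num) h0 ha hc
    have hba := pow_mul_eq_one_of_kComm_preserving hΦ (by norm_num) h1 hb ha
    have hbc := pow_mul_eq_one_of_kComm_preserving hΦ (by norm_num) h1 hb hc
    obtain rfl : b = c := mul_left_cancel₀ (left_ne_zero_of_mul_eq_one hab) (hab.trans hac.symm)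
    obtain rfl : a = b := mul_left_cancel₀ (left_ne_zero_of_mul_eq_one hba) (hba.trans hbc.symm)
    refine ⟨fun A => a * (a ^ k • Φ A - A) 1 1, a, by rw [pow_succ, hab], fun A => ?_⟩
    have h := eq_smul_one_of_commute_of_commute zero_ne_one
      (commute_smul_sub_of_kComm_preserving hΦ (disc 0 h0) ha A)
      (commute_smul_sub_of_kComm_preserving hΦ (disc 1 h1) hb A)
    rw [mul_smul, ← h, ← smul_add, add_sub_cancel, smul_smul, mul_comm, hab, one_smul]
  · rintro ⟨h, c, hc, hΦ⟩ A B
    rw [hΦ, hΦ, kComm_add_smul_one_left hk, kComm_smul_add_smul_one_right, kComm_smul, smul_smul,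
      ← pow_succ, hc, one_smul]
end

section
/- Let 𝔽 be ℝ or ℂ and let {A_i, B_i}_{i=1}^n and {C_j, D_j}_{j=1}^m be finite families in M₂(𝔽) such that Σ_{i=1}^n A_i T B_i = Σ_{j=1}^m C_j T D_j holds for every rank-one matrix T ∈ M₂(𝔽). If A_1, …, A_n are linearly independent, then each B_i is a linear combination of D_1, …, D_m. Similarly, if B_1, …, B_n are linearly independent, then each A_i is a linear combination of C_1, …, C_m. -/
theorem Matrix.rank_single_one {K : Type*} [Field K] {p q : Type*} [Fintype q] [DecidableEq p]
    [DecidableEq q] (b : p) (c : q) : (Matrix.single b c (1 : K)).rank = 1 := by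
  rw [Matrix.single_eq_single_vecMulVec_single]
  refine le_antisymm (Matrix.rank_vecMulVec_le _ _) (Nat.one_le_iff_ne_zero.mpr fun h => ?_)
  rw [Matrix.rank, Submodule.finrank_eq_zero, LinearMap.range_eq_bot] at h
  simpa [Matrix.vecMulVec_apply] using congrFun (LinearMap.congr_fun h (Pi.single c 1)) b

theorem LinearIndependent.mem_span_of_forall_dual_sum_smul_eq {K V W ι κ : Type*} [Field K]
    [AddCommGroup V] [Module K V] [AddCommGroup W] [Module K W] [Fintype ι] [Fintype κ]
    {a : ι → V} {b : ι → W} {c : κ → V} {d : κ → W} (ha : LinearIndependent K a)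
    (h : ∀ φ : Module.Dual K V, ∑ i, φ (a i) • b i = ∑ j, φ (c j) • d j) (i : ι) :
    b i ∈ Submodule.span K (Set.range d) := by
  classical
  obtain ⟨g, hg⟩ := (Finsupp.linearCombination K a).exists_leftInverse_of_injective
    (LinearMap.ker_eq_bot.mpr ha)
  have hga (k : ι) : g (a k) = Finsupp.single k 1 := by
    simpa using LinearMap.congr_fun hg (Finsupp.single k 1)
  have hb := h (Finsupp.lapply i ∘ₗ g)
  simp only [LinearMap.comp_apply, hga, Finsupp.lapply_apply, Finsupp.single_apply, ite_smul,
    one_smul, zero_smul, Finset.sum_ite_eq', Finset.mem_univ, if_true] at hb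
  rw [hb]
  exact Submodule.sum_mem _ fun j _ =>
    Submodule.smul_mem _ _ (Submodule.subset_span (Set.mem_range_self j))

/-- A linear functional may be applied to the left factors of an identity between sums of products
of matrix entries. -/
theorem Matrix.sum_dual_smul_eq_of_sum_mul_eq {K p q r s ι κ : Type*} [Field K] [Fintype p]
    [Fintype q] [Fintype ι] [Fintype κ]
    {A : ι → Matrix p q K} {B : ι → Matrix r s K} {C : κ → Matrix p q K} {D : κ → Matrix r s K}
    (h : ∀ a b c d, ∑ i, A i a b * B i c d = ∑ j, C j a b * D j c d)
    (φ : Module.Dual K (Matrix p q K)) : ∑ i, φ (A i) • B i = ∑ j, φ (C j) • D j := by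
  classical
  have hφ (M : Matrix p q K) : φ M = ∑ a, ∑ b, φ (Matrix.single a b 1) * M a b := by
    conv_lhs => rw [Matrix.matrix_eq_sum_single M]
    simp only [map_sum]
    refine Finset.sum_congr rfl fun a _ => Finset.sum_congr rfl fun b _ => ?_
    rw [← mul_one (M a b), ← smul_eq_mul, ← Matrix.smul_single, map_smul]
    simp [mul_comm]
  ext c d
  rw [Matrix.sum_apply, Matrix.sum_apply]
  simp only [Matrix.smul_apply, smul_eq_mul, hφ (A _), hφ (C _), Finset.sum_mul, mul_assoc]
  rw [Finset.sum_comm, Finset.sum_comm (s := (Finset.univ : Finset κ))]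
  refine Finset.sum_congr rfl fun a _ => ?_
  rw [Finset.sum_comm, Finset.sum_comm (s := (Finset.univ : Finset κ))]
  refine Finset.sum_congr rfl fun b _ => ?_
  rw [← Finset.mul_sum, ← Finset.mul_sum, h]

theorem rank_one_functional_identity {𝔽 : Type*} [RCLike 𝔽] {n m : ℕ}
    (A B : Fin n → Matrix (Fin 2) (Fin 2) 𝔽) (C D : Fin m → Matrix (Fin 2) (Fin 2) 𝔽)
    (h : ∀ T : Matrix (Fin 2) (Fin 2) 𝔽, T.rank = 1 →
      ∑ i, A i * T * B i = ∑ j, C j * T * D j) :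
    (LinearIndependent 𝔽 A → ∀ i, B i ∈ Submodule.span 𝔽 (Set.range D)) ∧
    (LinearIndependent 𝔽 B → ∀ i, A i ∈ Submodule.span 𝔽 (Set.range C)) := by
  have hentry (a b c d : Fin 2) :
      ∑ i, A i a b * B i c d = ∑ j, C j a b * D j c d := by
    have hT := congrFun (congrFun (h _ (Matrix.rank_single_one b c)) a) d
    simpa [Matrix.sum_apply, Matrix.mul_apply, Matrix.single_apply, ite_and] using hT
  refine ⟨fun hA => hA.mem_span_of_forall_dual_sum_smul_eq
      (Matrix.sum_dual_smul_eq_of_sum_mul_eq hentry),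
    fun hB => hB.mem_span_of_forall_dual_sum_smul_eq
      (Matrix.sum_dual_smul_eq_of_sum_mul_eq (C := D) (D := C) fun c d a b => ?_)⟩
  simpa only [mul_comm] using hentry a b c d
end

section
/- Let 𝔽 be ℝ or ℂ, let k ≥ 1 be an integer, and let Z ∈ M₂(𝔽). If [Z, A]_k = 0 for every rank-one idempotent matrix A ∈ M₂(𝔽) (i.e. every A with A² = A and rank A = 1), then there exists a scalar λ ∈ 𝔽 such that Z = λ·I. -/
theorem kComm_add_three_of_isIdempotentElem {𝔽 : Type*} [Field 𝔽]
    (Z : Matrix (Fin 2) (Fin 2) 𝔽) {E : Matrix (Fin 2) (Fin 2) 𝔽} (hE : E * E = E) (n : ℕ) :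
    kComm (n + 3) Z E = kComm (n + 1) Z E := by
  have h (X : Matrix (Fin 2) (Fin 2) 𝔽) : X * E * E = X * E := by rw [mul_assoc, hE]
  simp only [kComm, mul_sub, sub_mul, h, ← mul_assoc, hE]
  abel

theorem commute_of_kComm_succ_eq_zero {𝔽 : Type*} [Field 𝔽]
    {Z E : Matrix (Fin 2) (Fin 2) 𝔽} (hE : E * E = E) (n : ℕ) (h : kComm (n + 1) Z E = 0) :
    Z * E = E * Z := by
  induction n with
  | zero => exact sub_eq_zero.mp h
  | succ n ih =>
    apply ih
    rw [← kComm_add_three_of_isIdempotentElem Z hE n, kComm, h, zero_mul, mul_zero, sub_zero]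

theorem rank_of_one_x_zero_zero {𝔽 : Type*} [Field 𝔽] (x : 𝔽) :
    (!![1, x; 0, 0] : Matrix (Fin 2) (Fin 2) 𝔽).rank = 1 := by
  apply le_antisymm
  · have h : (!![1, x; 0, 0] : Matrix (Fin 2) (Fin 2) 𝔽) = Matrix.vecMulVec ![1, 0] ![1, x] := by
      ext i j
      fin_cases i <;> fin_cases j <;> simp [Matrix.vecMulVec_apply]
    rw [h]
    exact Matrix.rank_vecMulVec_le _ _
  · rw [Nat.one_le_iff_ne_zero, Ne, Matrix.rank, Submodule.finrank_eq_zero, LinearMap.range_eq_bot]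
    intro h
    simpa using congrFun (LinearMap.congr_fun h ![1, 0]) 0

theorem kcomm_vanishes_on_rank_one_idempotents_implies_scalar {𝔽 : Type*} [RCLike 𝔽]
    (k : ℕ) (hk : 1 ≤ k) (Z : Matrix (Fin 2) (Fin 2) 𝔽)
    (h : ∀ A : Matrix (Fin 2) (Fin 2) 𝔽, A * A = A → A.rank = 1 → kComm k Z A = 0) :
    ∃ lam : 𝔽, Z = lam • 1 := by
  obtain ⟨n, rfl⟩ := Nat.exists_eq_add_of_le' hk
  have hcomm (x : 𝔽) : Z * !![1, x; 0, 0] = !![1, x; 0, 0] * Z := by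
    have hE : (!![1, x; 0, 0] : Matrix (Fin 2) (Fin 2) 𝔽) * !![1, x; 0, 0] = !![1, x; 0, 0] := by
      ext i j
      fin_cases i <;> fin_cases j <;> simp [Matrix.mul_apply, Fin.sum_univ_two]
    exact commute_of_kComm_succ_eq_zero hE n (h _ hE (rank_of_one_x_zero_zero x))
  have hb : Z 0 1 = 0 := by
    simpa [Matrix.mul_apply, Fin.sum_univ_two] using (congrFun₂ (hcomm 0) 0 1).symm
  have hc : Z 1 0 = 0 := by
    simpa [Matrix.mul_apply, Fin.sum_univ_two] using congrFun₂ (hcomm 0) 1 0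
  have hd : Z 0 0 = Z 1 1 := by
    simpa [Matrix.mul_apply, Fin.sum_univ_two, hb] using congrFun₂ (hcomm 1) 0 1
  refine ⟨Z 0 0, ?_⟩
  ext i j
  fin_cases i <;> fin_cases j <;> simp [hb, hc, hd]
end

section
/- Let k ≥ 3 be an integer and let S ∈ M₂(ℂ). If [A, S]_k = 0 for every rank-one matrix A ∈ M₂(ℂ), then there exist a scalar λ ∈ ℂ and a matrix N ∈ M₂(ℂ) with N² = 0 such that S = λ·I + N. -/
/-- The third power of `ad S` is the discriminant of the characteristic polynomial of `S` times
`ad S`. -/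
theorem kComm_add_three {𝔽 : Type*} [Field 𝔽] (n : ℕ) (A S : Matrix (Fin 2) (Fin 2) 𝔽) :
    kComm (n + 3) A S = (S.trace ^ 2 - 4 * S.det) • kComm (n + 1) A S := by
  simp only [kComm]
  generalize kComm n A S = X
  ext i j
  fin_cases i <;> fin_cases j <;>
    simp [Matrix.mul_apply, Fin.sum_univ_two, Matrix.trace_fin_two, Matrix.det_fin_two] <;> ring

theorem kComm_one_eq_zero_of_discr_ne_zero {𝔽 : Type*} [Field 𝔽]
    {A S : Matrix (Fin 2) (Fin 2) 𝔽} (hS : S.trace ^ 2 - 4 * S.det ≠ 0) {n : ℕ}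
    (h : kComm (n + 1) A S = 0) : kComm 1 A S = 0 := by
  induction n with
  | zero => exact h
  | succ n ih =>
    refine ih ((smul_eq_zero_iff_right hS).mp ?_)
    rw [← kComm_add_three, kComm, h, zero_mul, mul_zero, sub_zero]

theorem Matrix.rank_single_one_s6 {𝔽 n : Type*} [Field 𝔽] [Fintype n] [DecidableEq n] (i j : n) :
    (Matrix.single i j (1 : 𝔽)).rank = 1 := by
  apply le_antisymm
  · rw [Matrix.single_eq_single_vecMulVec_single]
    exact Matrix.rank_vecMulVec_le _ _
  · rw [Nat.one_le_iff_ne_zero, Ne, Matrix.rank, Submodule.finrank_eq_zero, LinearMap.range_eq_bot]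
    intro h
    simpa using congrFun (LinearMap.congr_fun h (Pi.single j 1)) i

/-- If `S` commutes with all rank-one matrices, its discriminant vanishes. -/
theorem discr_eq_zero_of_kComm_one {𝔽 : Type*} [Field 𝔽] {S : Matrix (Fin 2) (Fin 2) 𝔽}
    (h : ∀ A : Matrix (Fin 2) (Fin 2) 𝔽, A.rank = 1 → kComm 1 A S = 0) :
    S.trace ^ 2 - 4 * S.det = 0 := by
  have h₁ := h _ (Matrix.rank_single_one_s6 0 0)
  have h₂ := h _ (Matrix.rank_single_one_s6 0 1)
  have hb : S 0 1 = 0 := by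
    simpa [kComm, Matrix.mul_apply, Matrix.single_apply] using congrFun₂ h₁ 0 1
  have had : S 1 1 - S 0 0 = 0 := by
    simpa [kComm, Matrix.mul_apply, Matrix.single_apply] using congrFun₂ h₂ 0 1
  rw [Matrix.trace_fin_two, Matrix.det_fin_two]
  linear_combination 4 * S 1 0 * hb + (S 1 1 - S 0 0) * had

theorem kcomm_zero_implies_scalar_plus_nilpotent_complex (k : ℕ) (hk : 3 ≤ k)
    (S : Matrix (Fin 2) (Fin 2) ℂ)
    (h : ∀ A : Matrix (Fin 2) (Fin 2) ℂ, A.rank = 1 → kComm k A S = 0) :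
    ∃ (lam : ℂ) (N : Matrix (Fin 2) (Fin 2) ℂ), N * N = 0 ∧ S = lam • 1 + N := by
  have hD : S.trace ^ 2 - 4 * S.det = 0 := by
    by_contra hD
    obtain ⟨n, rfl⟩ : ∃ n, k = n + 1 := ⟨k - 1, by omega⟩
    exact hD (discr_eq_zero_of_kComm_one fun A hA =>
      kComm_one_eq_zero_of_discr_ne_zero hD (h A hA))
  refine ⟨S.trace / 2, S - (S.trace / 2) • 1, ?_, by abel⟩
  rw [Matrix.trace_fin_two, Matrix.det_fin_two] at hD
  ext i j
  fin_cases i <;> fin_cases j <;>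
    simp [Matrix.mul_apply, Fin.sum_univ_two, Matrix.trace_fin_two]
  · linear_combination hD / 4
  · ring
  · ring
  · linear_combination hD / 4
end

section
/- Let 𝔽 be ℝ or ℂ, let k ≥ 1 be an integer, and let Φ : M₂(𝔽) → M₂(𝔽) be a map whose range contains every rank-one matrix and which satisfies [Φ(A), Φ(B)]_k = [A, B]_k for all A, B ∈ M₂(𝔽). Then for any A, B ∈ M₂(𝔽) there exists a scalar λ_{A,B} ∈ 𝔽 such that Φ(A + B) = Φ(A) + Φ(B) + λ_{A,B}·I. -/
theorem kComm_sub_left {𝔽 : Type*} [Field 𝔽] (k : ℕ) (X Y T : Matrix (Fin 2) (Fin 2) 𝔽) :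
    kComm k (X - Y) T = kComm k X T - kComm k Y T := by
  induction k with
  | zero => rfl
  | succ n ih => simp only [kComm, ih]; noncomm_ring

theorem kComm_add_left {𝔽 : Type*} [Field 𝔽] (k : ℕ) (X Y T : Matrix (Fin 2) (Fin 2) 𝔽) :
    kComm k (X + Y) T = kComm k X T + kComm k Y T := by
  induction k with
  | zero => rfl
  | succ n ih => simp only [kComm, ih]; noncomm_ring

/-- An element whose double commutator with an idempotent vanishes commutes with it. -/
theorem IsIdempotentElem.commutator_eq_zero {R : Type*} [Ring R] {T Y : R}
    (hT : IsIdempotentElem T) (h : (Y * T - T * Y) * T - T * (Y * T - T * Y) = 0) :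
    Y * T - T * Y = 0 := by
  have hT' : T * T = T := hT
  have hl : T * Y = T * Y * T := by
    have e : T * ((Y * T - T * Y) * T - T * (Y * T - T * Y)) =
        T * Y * (T * T) - (T * T) * Y * T - (T * T) * Y * T + T * T * T * Y := by noncomm_ring
    rw [h, mul_zero, hT', hT'] at e
    rw [← sub_eq_zero, e]
    abel
  have hr : Y * T = T * Y * T := by
    have e : ((Y * T - T * Y) * T - T * (Y * T - T * Y)) * T =
        Y * (T * T * T) - T * Y * (T * T) - T * Y * (T * T) + (T * T) * Y * T := by noncomm_ring
    rw [h, zero_mul, hT', hT'] at e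
    rw [← sub_eq_zero, e]
    abel
  rw [hr, ← hl, sub_self]

theorem commute_of_kComm_eq_zero_s8 {𝔽 : Type*} [Field 𝔽] {X T : Matrix (Fin 2) (Fin 2) 𝔽}
    (hT : IsIdempotentElem T) (n : ℕ) (h : kComm (n + 1) X T = 0) : X * T = T * X := by
  induction n with
  | zero => exact sub_eq_zero.mp h
  | succ n ih => exact ih (hT.commutator_eq_zero h)

theorem rank_of_one_zero_row {𝔽 : Type*} [Field 𝔽] (b : 𝔽) :
    (!![1, b; 0, 0] : Matrix (Fin 2) (Fin 2) 𝔽).rank = 1 := by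
  have e : (!![1, b; 0, 0] : Matrix (Fin 2) (Fin 2) 𝔽) = Matrix.vecMulVec ![1, 0] ![1, b] := by
    ext i j; fin_cases i <;> fin_cases j <;> simp [Matrix.vecMulVec_apply]
  refine le_antisymm (e ▸ Matrix.rank_vecMulVec_le _ _) (Nat.one_le_iff_ne_zero.mpr fun h => ?_)
  rw [Matrix.rank, Module.finrank_zero_iff, Submodule.subsingleton_iff_eq_bot,
    LinearMap.range_eq_bot] at h
  simpa using congrFun (LinearMap.congr_fun h ![1, 0]) 0

theorem isIdempotentElem_of_one_zero_row {𝔽 : Type*} [Field 𝔽] (b : 𝔽) :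
    IsIdempotentElem (!![1, b; 0, 0] : Matrix (Fin 2) (Fin 2) 𝔽) := by
  ext i j; fin_cases i <;> fin_cases j <;> simp

theorem phi_almost_additive {𝔽 : Type*} [RCLike 𝔽] (k : ℕ) (hk : 1 ≤ k)
    (Φ : Matrix (Fin 2) (Fin 2) 𝔽 → Matrix (Fin 2) (Fin 2) 𝔽)
    (hrange : ∀ T : Matrix (Fin 2) (Fin 2) 𝔽, T.rank = 1 → ∃ A, Φ A = T)
    (hpres : ∀ A B : Matrix (Fin 2) (Fin 2) 𝔽, kComm k (Φ A) (Φ B) = kComm k A B) :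
    ∀ A B : Matrix (Fin 2) (Fin 2) 𝔽, ∃ lam : 𝔽, Φ (A + B) = Φ A + Φ B + lam • 1 := by
  intro A B
  obtain ⟨n, rfl⟩ := Nat.exists_eq_add_of_le' hk
  obtain ⟨X, hX⟩ : ∃ X, X = Φ (A + B) - (Φ A + Φ B) := ⟨_, rfl⟩
  have hcomm (b : 𝔽) : X * !![1, b; 0, 0] = !![1, b; 0, 0] * X := by
    obtain ⟨C, hC⟩ := hrange _ (rank_of_one_zero_row b)
    refine commute_of_kComm_eq_zero_s8 (isIdempotentElem_of_one_zero_row b) n ?_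
    rw [hX, ← hC, kComm_sub_left, kComm_add_left, hpres, hpres, hpres, kComm_add_left, sub_self]
  have h01 : X 0 1 = 0 := by
    simpa [Matrix.mul_apply, Fin.sum_univ_two] using (congrFun (congrFun (hcomm 0) 0) 1).symm
  have h10 : X 1 0 = 0 := by
    simpa [Matrix.mul_apply, Fin.sum_univ_two] using congrFun (congrFun (hcomm 0) 1) 0
  have h11 : X 0 0 = X 1 1 := by
    simpa [Matrix.mul_apply, Fin.sum_univ_two, h01] using congrFun (congrFun (hcomm 1) 0) 1
  refine ⟨X 0 0, ?_⟩
  have hscalar : X = X 0 0 • (1 : Matrix (Fin 2) (Fin 2) 𝔽) := by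
    ext i j
    fin_cases i <;> fin_cases j <;> simp [h01, h10, h11]
  rw [← hscalar, hX, add_sub_cancel]
end

section
/- Let k ≥ 1 be an integer, let S ∈ M₂(ℂ), and let x, f ∈ ℂ² and α, β ∈ ℂ satisfy S·x = α·x and S*·f = conj(β)·f, where S* is the conjugate transpose of S. Then the rank-one matrix A = x·f* (the matrix with entries A_{ij} = x_i·conj(f_j)) satisfies [A, S]_k = (β − α)^k · A. -/
theorem kComm_eq_pow_smul {𝔽 : Type*} [Field 𝔽] {A S : Matrix (Fin 2) (Fin 2) 𝔽} {α β : 𝔽}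
    (hSA : S * A = α • A) (hAS : A * S = β • A) (k : ℕ) :
    kComm k A S = (β - α) ^ k • A := by
  induction k with
  | zero => simp [kComm]
  | succ n ih =>
    rw [kComm, ih, smul_mul_assoc, mul_smul_comm, hSA, hAS, ← smul_sub, ← sub_smul, smul_smul,
      pow_succ]

theorem kcomm_rank_one_with_eigenvectors (k : ℕ) (hk : 1 ≤ k)
    (S : Matrix (Fin 2) (Fin 2) ℂ) (x f : Fin 2 → ℂ) (α β : ℂ)
    (hx : S.mulVec x = α • x) (hf : S.conjTranspose.mulVec f = (starRingEnd ℂ) β • f)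
    (A : Matrix (Fin 2) (Fin 2) ℂ)
    (hA : A = Matrix.of fun i j => x i * (starRingEnd ℂ) (f j)) :
    kComm k A S = (β - α) ^ k • A := by
  have hA' : A = Matrix.vecMulVec x (star f) := hA
  refine kComm_eq_pow_smul ?_ ?_ k
  · rw [hA', Matrix.mul_vecMulVec, hx, Matrix.smul_vecMulVec]
  · have hf' : Matrix.vecMul (star f) S = β • star f := by
      rw [← S.conjTranspose_conjTranspose, ← Matrix.star_mulVec, hf, star_smul]
      simp
    rw [hA', Matrix.vecMulVec_mul, hf', Matrix.vecMulVec_smul]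
end

section
/- Let 𝔽 be ℝ or ℂ, let k be an odd positive integer, and let A, B ∈ M₂(𝔽) with B² = c·I for some scalar c ∈ 𝔽. Then [A, B]_k = c^{(k−1)/2} · 2^{k−1} · (AB − BA). -/
/-- If `B ^ 2` is the scalar `c`, then the second commutator of `[A, B]` with `B` is
`4 * c • [A, B]`. -/
theorem commutator_commutator_of_sq_eq_smul_one {R M : Type*} [CommRing R] [Ring M] [Algebra R M]
    {B : M} {c : R} (hB : B * B = c • 1) (A : M) :
    ((A * B - B * A) * B - B * (A * B - B * A)) * B -
        B * ((A * B - B * A) * B - B * (A * B - B * A)) =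
      (4 * c) • (A * B - B * A) := by
  have hr (X : M) : X * B * B = c • X := by
    rw [mul_assoc, hB, mul_smul_comm, mul_one]
  have hl (X : M) : B * (B * X) = c • X := by
    rw [← mul_assoc, hB, smul_mul_assoc, one_mul]
  simp only [sub_mul, mul_sub, hr, hl, mul_assoc, mul_smul_comm, smul_mul_assoc]
  module

/-- Commuting twice more with `B` multiplies an odd iterated commutator by `4 * c`. -/
theorem kComm_two_mul_add_one {K : Type*} [Field K] {A B : Matrix (Fin 2) (Fin 2) K} {c : K}
    (hB : B * B = c • 1) (m : ℕ) :
    kComm (2 * m + 1) A B = (4 * c) ^ m • (A * B - B * A) := by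
  induction m with
  | zero => simp [kComm]
  | succ m ih =>
    have h := commutator_commutator_of_sq_eq_smul_one hB (kComm (2 * m) A B)
    change kComm (2 * m + 1 + 1 + 1) A B = (4 * c) • kComm (2 * m + 1) A B at h
    rw [show 2 * (m + 1) + 1 = 2 * m + 1 + 1 + 1 by ring, h, ih, smul_smul, pow_succ']

theorem kcomm_odd_with_square_scalar {𝔽 : Type*} [RCLike 𝔽] (k : ℕ) (hodd : Odd k)
    (hk : 1 ≤ k) (A B : Matrix (Fin 2) (Fin 2) 𝔽) (c : 𝔽) (hB : B * B = c • 1) :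
    kComm k A B = (c ^ ((k - 1) / 2) * 2 ^ (k - 1)) • (A * B - B * A) := by
  obtain ⟨m, rfl⟩ := hodd
  rw [kComm_two_mul_add_one hB, Nat.add_sub_cancel, Nat.mul_div_cancel_left m two_pos,
    pow_mul, mul_pow, mul_comm]
  norm_num
end

section
/- Let 𝔽 be ℝ or ℂ, let k ≥ 2 be an even integer, and let A, B ∈ M₂(𝔽) with B² = c·I for some scalar c ∈ 𝔽. Then [A, B]_k = c^{(k−2)/2} · 2^{k−1} · (c·A − B·A·B). -/
/-- The double commutator with a square root of a scalar matrix. -/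
theorem kComm_add_two_of_mul_self {𝔽 : Type*} [Field 𝔽] (n : ℕ)
    {A B : Matrix (Fin 2) (Fin 2) 𝔽} {c : 𝔽} (hB : B * B = c • 1) :
    kComm (n + 2) A B = (2 : 𝔽) • (c • kComm n A B - B * kComm n A B * B) := by
  have h₁ (X : Matrix (Fin 2) (Fin 2) 𝔽) : X * B * B = c • X := by
    rw [mul_assoc, hB, mul_smul_comm, mul_one]
  have h₂ (X : Matrix (Fin 2) (Fin 2) 𝔽) : B * (B * X) = c • X := by
    rw [← mul_assoc, hB, smul_mul_assoc, one_mul]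
  simp only [kComm, sub_mul, mul_sub, h₁, h₂, ← mul_assoc B _ B]
  module

/-- The iterated commutators of even positive order with a square root of a scalar matrix. -/
theorem kComm_two_mul_add_two_of_mul_self {𝔽 : Type*} [Field 𝔽] (m : ℕ)
    {A B : Matrix (Fin 2) (Fin 2) 𝔽} {c : 𝔽} (hB : B * B = c • 1) :
    kComm (2 * m + 2) A B = (c ^ m * 2 ^ (2 * m + 1)) • (c • A - B * A * B) := by
  induction m with
  | zero => simpa [kComm] using kComm_add_two_of_mul_self 0 (A := A) hB
  | succ m ih =>
    have h : B * (B * A * B) * B = (c * c) • A := by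
      calc B * (B * A * B) * B = (B * B) * A * (B * B) := by simp only [mul_assoc]
        _ = (c * c) • A := by simp [hB, smul_smul]
    rw [show 2 * (m + 1) + 2 = 2 * m + 2 + 2 by ring, kComm_add_two_of_mul_self _ hB, ih]
    simp only [mul_smul_comm, smul_mul_assoc, mul_sub, sub_mul, h]
    module

theorem kcomm_even_with_square_scalar {𝔽 : Type*} [RCLike 𝔽] (k : ℕ) (heven : Even k)
    (hk : 2 ≤ k) (A B : Matrix (Fin 2) (Fin 2) 𝔽) (c : 𝔽) (hB : B * B = c • 1) :
    kComm k A B = (c ^ ((k - 2) / 2) * 2 ^ (k - 1)) • (c • A - B * A * B) := by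
  obtain ⟨m, rfl⟩ : ∃ m, k = 2 * m + 2 := by
    obtain ⟨r, rfl⟩ := heven
    exact ⟨r - 1, by omega⟩
  rw [show (2 * m + 2 - 2) / 2 = m by omega, show 2 * m + 2 - 1 = 2 * m + 1 by omega]
  exact kComm_two_mul_add_two_of_mul_self m hB
end
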